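/- Let α > 0 and let k, n be integers with 1 ≤ k < k+1 ≤ n. Then the function f : [0,1] → ℝ defined by f(s) = H_α((1−s)·U_k + s·U_{k+1}) is continuous and strictly increasing, with f(0) = log k and f(1) = log(k+1); in particular it is a bijection from [0,1] onto [log k, log(k+1)]. -/

import Mathlib

open Real Filter

/-- Rényi entropy of order `α` of a vector `p` on `n` points (order 1 = Shannon entropy). -/
noncomputable def renyiH {n : ℕ} (α : ℝ) (p : Fin n → ℝ) : ℝ :=
  if α = 1 then -∑ i, p i * Real.log (p i)
  else (1 / (1 - α)) * Real.log (∑ i, p i ^ α)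

/-- `unif n k` : probability vector on `n` points with `k` coordinates equal to `1/k`
and the remaining coordinates equal to `0`. -/
noncomputable def unif (n k : ℕ) : Fin n → ℝ :=
  fun i => if (i : ℕ) < k then (k : ℝ)⁻¹ else 0

/-- A sum over the coordinates of the mixture `(1 - s) * unif n k + s * unif n (k + 1)`. -/
theorem sum_comp_unif_mixture {n k : ℕ} (hkn : k + 1 ≤ n) (g : ℝ → ℝ) (hg : g 0 = 0) (s : ℝ) :
    ∑ i, g ((1 - s) * unif n k i + s * unif n (k + 1) i) =
      k * g ((1 - s) * (k : ℝ)⁻¹ + s * ((k : ℝ) + 1)⁻¹) + g (s * ((k : ℝ) + 1)⁻¹) := by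
  obtain ⟨m, rfl⟩ := Nat.exists_eq_add_of_le hkn
  simp only [unif]
  rw [Fin.sum_univ_eq_sum_range (fun i : ℕ => g ((1 - s) * (if i < k then (k : ℝ)⁻¹ else 0) +
    s * (if i < k + 1 then ((k + 1 : ℕ) : ℝ)⁻¹ else 0))), Finset.sum_range_add,
    Finset.sum_range_succ, Finset.sum_eq_zero (s := Finset.range m), add_zero]
  · congr 1
    · rw [Finset.sum_congr rfl (g := fun _ => g ((1 - s) * (k : ℝ)⁻¹ + s * ((k : ℝ) + 1)⁻¹))]
      · simp
      · intro i hi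
        have hik := Finset.mem_range.1 hi
        simp [hik, Nat.lt_succ_of_lt hik]
    · simp
  · intro i _
    simp [show ¬ k + 1 + i < k by omega, show ¬ k + 1 + i ≤ k by omega, hg]

/-- Transferring mass from `k` equal large coordinates to a smaller one increases the sum of a
strictly concave function. -/
theorem StrictConcaveOn.add_lt_add_of_transfer {g : ℝ → ℝ} (hg : StrictConcaveOn ℝ (Set.Ici 0) g)
    {c a₁ a₂ b₁ b₂ : ℝ} (hb₁ : 0 ≤ b₁) (hb : b₁ < b₂) (hba : b₂ ≤ a₂) (ha : a₂ < a₁)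
    (hc : c * (a₁ - a₂) = b₂ - b₁) :
    c * g a₁ + g b₁ < c * g a₂ + g b₂ := by
  have h₁ := hg.slope_anti_adjacent (x := b₁) (y := b₂) (z := a₁) hb₁
    (Set.mem_Ici.2 (by linarith)) hb (by linarith)
  have h₂ : (g a₁ - g a₂) / (a₁ - a₂) ≤ (g a₁ - g b₂) / (a₁ - b₂) := by
    rcases hba.eq_or_lt with rfl | hlt
    · rfl
    · have h := hg.slope_anti_adjacent (x := b₂) (y := a₂) (z := a₁)
        (Set.mem_Ici.2 (by linarith)) (Set.mem_Ici.2 (by linarith)) hlt ha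
      rw [div_lt_div_iff₀ (by linarith) (by linarith)] at h
      rw [div_le_div_iff₀ (by linarith) (by linarith)]
      nlinarith
  have h₃ := h₂.trans_lt h₁
  have ha' : a₁ - a₂ ≠ 0 := by linarith
  rw [lt_div_iff₀ (by linarith), ← hc] at h₃
  have h₄ : (g a₁ - g a₂) / (a₁ - a₂) * (c * (a₁ - a₂)) = c * (g a₁ - g a₂) := by
    field_simp
  linarith

theorem StrictConcaveOn.strictMonoOn_sum_unif_mixture {n k : ℕ} (hk : 1 ≤ k) (hkn : k + 1 ≤ n)
    {g : ℝ → ℝ} (hg : StrictConcaveOn ℝ (Set.Ici 0) g) (hg₀ : g 0 = 0) :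
    StrictMonoOn (fun s : ℝ => ∑ i, g ((1 - s) * unif n k i + s * unif n (k + 1) i))
      (Set.Icc 0 1) := by
  intro s hs t ht hst
  have hk₀ : (0 : ℝ) < k := by exact_mod_cast hk
  have hinv : ((k : ℝ) + 1)⁻¹ < (k : ℝ)⁻¹ := inv_strictAnti₀ hk₀ (by linarith)
  have hpos : (0 : ℝ) < ((k : ℝ) + 1)⁻¹ := by positivity
  simp only [sum_comp_unif_mixture hkn g hg₀]
  refine hg.add_lt_add_of_transfer (mul_nonneg hs.1 hpos.le) (by gcongr) ?_ ?_ ?_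
  · have := mul_nonneg (sub_nonneg.2 ht.2) (inv_pos.2 hk₀).le
    linarith
  · nlinarith
  · field_simp
    ring

theorem sum_rpow_unif_mixture_pos {n k : ℕ} (hk : 1 ≤ k) (hkn : k + 1 ≤ n) {α : ℝ} (hα : 0 < α)
    {s : ℝ} (hs : s ∈ Set.Icc (0 : ℝ) 1) :
    0 < ∑ i, ((1 - s) * unif n k i + s * unif n (k + 1) i) ^ α := by
  rw [sum_comp_unif_mixture hkn (fun x => x ^ α) (Real.zero_rpow hα.ne')]
  have hk₀ : (0 : ℝ) < k := by exact_mod_cast hk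
  have hinv : ((k : ℝ) + 1)⁻¹ < (k : ℝ)⁻¹ := inv_strictAnti₀ hk₀ (by linarith)
  have hpos : (0 : ℝ) < ((k : ℝ) + 1)⁻¹ := by positivity
  have ha : 0 < (1 - s) * (k : ℝ)⁻¹ + s * ((k : ℝ) + 1)⁻¹ := by
    nlinarith [mul_nonneg (sub_nonneg.2 hs.2) (sub_nonneg.2 hinv.le)]
  have hb : 0 ≤ s * ((k : ℝ) + 1)⁻¹ := mul_nonneg hs.1 hpos.le
  exact add_pos_of_pos_of_nonneg (mul_pos hk₀ (Real.rpow_pos_of_pos ha α)) (Real.rpow_nonneg hb α)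

theorem renyiH_one {n : ℕ} (p : Fin n → ℝ) : renyiH 1 p = ∑ i, negMulLog (p i) := by
  simp [renyiH, negMulLog, Finset.sum_neg_distrib]

theorem continuousOn_renyiH_unif_mixture {n k : ℕ} (hk : 1 ≤ k) (hkn : k + 1 ≤ n) {α : ℝ}
    (hα : 0 < α) :
    ContinuousOn (fun s : ℝ => renyiH α (fun i => (1 - s) * unif n k i + s * unif n (k + 1) i))
      (Set.Icc 0 1) := by
  rcases eq_or_ne α 1 with rfl | h
  · simp only [renyiH_one]
    exact Continuous.continuousOn (by fun_prop)
  · simp only [renyiH, if_neg h]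
    refine ContinuousOn.mul continuousOn_const (ContinuousOn.log ?_ fun s hs =>
      (sum_rpow_unif_mixture_pos hk hkn hα hs).ne')
    exact (continuous_finsetSum _ fun i _ =>
      Continuous.rpow_const (by fun_prop) fun _ => Or.inr hα.le).continuousOn

theorem strictMonoOn_renyiH_unif_mixture {n k : ℕ} (hk : 1 ≤ k) (hkn : k + 1 ≤ n) {α : ℝ}
    (hα : 0 < α) :
    StrictMonoOn (fun s : ℝ => renyiH α (fun i => (1 - s) * unif n k i + s * unif n (k + 1) i))
      (Set.Icc 0 1) := by
  rcases lt_trichotomy α 1 with h | rfl | h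
  · intro s hs t ht hst
    simp only [renyiH, if_neg h.ne]
    refine mul_lt_mul_of_pos_left (Real.log_lt_log (sum_rpow_unif_mixture_pos hk hkn hα hs) ?_)
      (one_div_pos.2 (sub_pos.2 h))
    exact (Real.strictConcaveOn_rpow hα h).strictMonoOn_sum_unif_mixture hk hkn
      (Real.zero_rpow hα.ne') hs ht hst
  · simp only [renyiH_one]
    exact strictConcaveOn_negMulLog.strictMonoOn_sum_unif_mixture hk hkn negMulLog_zero
  · intro s hs t ht hst
    simp only [renyiH, if_neg h.ne']
    refine mul_lt_mul_of_neg_left (Real.log_lt_log (sum_rpow_unif_mixture_pos hk hkn hα ht) ?_)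
      (one_div_neg.2 (sub_neg.2 h))
    have key := (strictConvexOn_rpow h).neg.strictMonoOn_sum_unif_mixture hk hkn
      (by simp [Real.zero_rpow hα.ne']) hs ht hst
    simpa [Finset.sum_neg_distrib] using key

/-- The uniform distribution on `k` points has Rényi entropy `log k` at every order. -/
theorem renyiH_unif {n k : ℕ} (hk : 1 ≤ k) (hkn : k ≤ n) {α : ℝ} (hα : 0 < α) :
    renyiH α (unif n k) = Real.log k := by
  have hk₀ : (0 : ℝ) < k := by exact_mod_cast hk
  have hsum (g : ℝ → ℝ) (hg : g 0 = 0) : ∑ i, g (unif n k i) = k * g (k : ℝ)⁻¹ := by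
    obtain ⟨m, rfl⟩ := Nat.exists_eq_add_of_le' hk
    have h := sum_comp_unif_mixture hkn g hg 1
    simp only [sub_self, zero_mul, zero_add, one_mul] at h
    rw [h]
    push_cast
    ring
  rcases eq_or_ne α 1 with rfl | h
  · rw [renyiH_one, hsum _ negMulLog_zero, negMulLog, Real.log_inv]
    field_simp
  · have h' : 1 - α ≠ 0 := sub_ne_zero.2 h.symm
    rw [renyiH, if_neg h, hsum (fun x => x ^ α) (Real.zero_rpow hα.ne'),
      Real.log_mul hk₀.ne' (Real.rpow_pos_of_pos (inv_pos.2 hk₀) α).ne',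
      Real.log_rpow (inv_pos.2 hk₀), Real.log_inv]
    field_simp
    ring

theorem renyi_mixture_strictMono_on_interval
    (α : ℝ) (hα : 0 < α) (n k : ℕ) (hk : 1 ≤ k) (hkn : k + 1 ≤ n) :
    ContinuousOn
        (fun s : ℝ => renyiH α (fun i => (1 - s) * unif n k i + s * unif n (k + 1) i))
        (Set.Icc 0 1) ∧
      StrictMonoOn
        (fun s : ℝ => renyiH α (fun i => (1 - s) * unif n k i + s * unif n (k + 1) i))
        (Set.Icc 0 1) ∧
      renyiH α (fun i => (1 - (0 : ℝ)) * unif n k i + (0 : ℝ) * unif n (k + 1) i)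
        = Real.log k ∧
      renyiH α (fun i => (1 - (1 : ℝ)) * unif n k i + (1 : ℝ) * unif n (k + 1) i)
        = Real.log (k + 1) ∧
      Set.BijOn
        (fun s : ℝ => renyiH α (fun i => (1 - s) * unif n k i + s * unif n (k + 1) i))
        (Set.Icc 0 1) (Set.Icc (Real.log k) (Real.log (k + 1))) := by
  have hcont := continuousOn_renyiH_unif_mixture hk hkn hα
  have hmono := strictMonoOn_renyiH_unif_mixture hk hkn hα
  have h₀ : renyiH α (fun i => (1 - (0 : ℝ)) * unif n k i + (0 : ℝ) * unif n (k + 1) i)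
      = Real.log k := by
    simpa using renyiH_unif hk (Nat.le_of_succ_le hkn) hα
  have h₁ : renyiH α (fun i => (1 - (1 : ℝ)) * unif n k i + (1 : ℝ) * unif n (k + 1) i)
      = Real.log (k + 1) := by
    simpa using renyiH_unif (Nat.le_add_left 1 k) hkn hα
  refine ⟨hcont, hmono, h₀, h₁, ?_, hmono.injOn, ?_⟩
  · have := hmono.monotoneOn.mapsTo_Icc
    simpa only [h₀, h₁] using this
  · have := intermediate_value_Icc zero_le_one hcont
    simpa only [Set.SurjOn, h₀, h₁] using this
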